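/- Let ρ_c := ρ(−1, 0, 0) (which is a positive semidefinite density matrix). Then F_RSP(ρ_c) = 0, while for every p ∈ (0,1), F_RSP(Φ_p(ρ_c)) = ½ · min{ (1 − p)², p⁴ } > 0. Hence a state useless for remote state preparation can be made useful (with strictly positive RSP-fidelity) by a local amplitude damping channel. -/

import Mathlib

open Matrix Kronecker ComplexOrder

noncomputable section

def pauli : Fin 3 → Matrix (Fin 2) (Fin 2) ℂ :=
  ![!![0, 1; 1, 0], !![0, -Complex.I; Complex.I, 0], !![1, 0; 0, -1]]

def corr (ρ : Matrix (Fin 2 × Fin 2) (Fin 2 × Fin 2) ℂ) : Matrix (Fin 3) (Fin 3) ℝ :=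
  Matrix.of fun k l => (Matrix.trace (ρ * (pauli k ⊗ₖ pauli l))).re

def lambdaMax (M : Matrix (Fin 3) (Fin 3) ℝ) : ℝ :=
  sSup {x : ℝ | ∃ v : Fin 3 → ℝ, v ≠ 0 ∧ M.mulVec v = x • v}

def Frsp (ρ : Matrix (Fin 2 × Fin 2) (Fin 2 × Fin 2) ℂ) : ℝ :=
  (1 / 2) * (Matrix.trace ((corr ρ)ᵀ * corr ρ) - lambdaMax ((corr ρ)ᵀ * corr ρ))

def damp (p : ℝ) : Fin 2 → Matrix (Fin 2) (Fin 2) ℂ :=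
  ![!![1, 0; 0, (Real.sqrt (1 - p) : ℂ)], !![0, (Real.sqrt p : ℂ); 0, 0]]

def Phi (p : ℝ) (ρ : Matrix (Fin 2 × Fin 2) (Fin 2 × Fin 2) ℂ) :
    Matrix (Fin 2 × Fin 2) (Fin 2 × Fin 2) ℂ :=
  ∑ i : Fin 2, ∑ j : Fin 2, (damp p i ⊗ₖ damp p j) * ρ * (damp p i ⊗ₖ damp p j)ᴴ

def bellDiag (c₁ c₂ c₃ : ℝ) : Matrix (Fin 2 × Fin 2) (Fin 2 × Fin 2) ℂ :=
  (1 / 4 : ℂ) • (1 + (c₁ : ℂ) • (pauli 0 ⊗ₖ pauli 0) + (c₂ : ℂ) • (pauli 1 ⊗ₖ pauli 1)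
    + (c₃ : ℂ) • (pauli 2 ⊗ₖ pauli 2))

def bloch (ρ : Matrix (Fin 2 × Fin 2) (Fin 2 × Fin 2) ℂ) : Fin 3 → ℝ :=
  fun k => (Matrix.trace (ρ * (pauli k ⊗ₖ (1 : Matrix (Fin 2) (Fin 2) ℂ)))).re

def Dg (ρ : Matrix (Fin 2 × Fin 2) (Fin 2 × Fin 2) ℂ) : ℝ :=
  (1 / 2) * ((∑ k, bloch ρ k ^ 2) + Matrix.trace (corr ρ * (corr ρ)ᵀ)
    - lambdaMax (Matrix.vecMulVec (bloch ρ) (bloch ρ) + corr ρ * (corr ρ)ᵀ))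


/-- The single-qubit amplitude damping channel. -/
def amplitudeDamping (p : ℝ) (X : Matrix (Fin 2) (Fin 2) ℂ) : Matrix (Fin 2) (Fin 2) ℂ :=
  ∑ i : Fin 2, damp p i * X * (damp p i)ᴴ

lemma Phi_kronecker (p : ℝ) (X Y : Matrix (Fin 2) (Fin 2) ℂ) :
    Phi p (X ⊗ₖ Y) = amplitudeDamping p X ⊗ₖ amplitudeDamping p Y := by
  simp only [Phi, amplitudeDamping, Fin.sum_univ_two, conjTranspose_kronecker,
    ← mul_kronecker_mul, add_kronecker, kronecker_add]
  abel

lemma Phi_smul_sub (p : ℝ) (c : ℂ) (ρ τ : Matrix (Fin 2 × Fin 2) (Fin 2 × Fin 2) ℂ) :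
    Phi p (c • (ρ - τ)) = c • (Phi p ρ - Phi p τ) := by
  simp [Phi, Matrix.mul_sub, Matrix.sub_mul, Finset.sum_sub_distrib, smul_sub]

lemma bellDiag_neg_one_zero_zero :
    bellDiag (-1) 0 0 = (1 / 4 : ℂ) • (1 ⊗ₖ 1 - pauli 0 ⊗ₖ pauli 0) := by
  simp [bellDiag, sub_eq_add_neg]

lemma amplitudeDamping_one {p : ℝ} (h₀ : 0 ≤ p) (h₁ : p ≤ 1) :
    amplitudeDamping p 1 = !![1 + (p : ℂ), 0; 0, 1 - (p : ℂ)] := by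
  have hp : (Real.sqrt p : ℂ) * Real.sqrt p = p := by
    rw [← Complex.ofReal_mul, Real.mul_self_sqrt h₀]
  have hq : (Real.sqrt (1 - p) : ℂ) * Real.sqrt (1 - p) = 1 - p := by
    rw [← Complex.ofReal_mul, Real.mul_self_sqrt (sub_nonneg.mpr h₁)]
    push_cast; rfl
  ext i j
  fin_cases i <;> fin_cases j <;>
    simp [amplitudeDamping, damp, vecMul, dotProduct, Fin.sum_univ_two, hp, hq]

lemma amplitudeDamping_pauli_zero (p : ℝ) :
    amplitudeDamping p (pauli 0) = (Real.sqrt (1 - p) : ℂ) • pauli 0 := by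
  ext i j
  fin_cases i <;> fin_cases j <;>
    simp [amplitudeDamping, damp, pauli, vecMul, dotProduct, Fin.sum_univ_two]

lemma corr_smul_kronecker_sub_kronecker (c : ℂ) (X Y Z W : Matrix (Fin 2) (Fin 2) ℂ)
    (k l : Fin 3) :
    corr (c • (X ⊗ₖ Y - Z ⊗ₖ W)) k l =
      (c * (trace (X * pauli k) * trace (Y * pauli l) -
        trace (Z * pauli k) * trace (W * pauli l))).re := by
  simp [corr, Matrix.sub_mul, ← mul_kronecker_mul, trace_kronecker, trace_sub,
    -Complex.mul_re, -Complex.sub_re]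

lemma corr_bellDiag_neg_one_zero_zero :
    corr (bellDiag (-1) 0 0) = diagonal ![-1, 0, 0] := by
  rw [bellDiag_neg_one_zero_zero]
  ext k l
  rw [corr_smul_kronecker_sub_kronecker]
  fin_cases k <;> fin_cases l <;>
    simp [pauli, trace_fin_two]; norm_num

lemma corr_Phi_bellDiag_neg_one_zero_zero {p : ℝ} (h₀ : 0 ≤ p) (h₁ : p ≤ 1) :
    corr (Phi p (bellDiag (-1) 0 0)) = diagonal ![-(1 - p), 0, p ^ 2] := by
  have hq : Real.sqrt (1 - p) * Real.sqrt (1 - p) = 1 - p :=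
    Real.mul_self_sqrt (sub_nonneg.mpr h₁)
  rw [bellDiag_neg_one_zero_zero, Phi_smul_sub, Phi_kronecker, Phi_kronecker,
    amplitudeDamping_one h₀ h₁, amplitudeDamping_pauli_zero]
  ext k l
  rw [corr_smul_kronecker_sub_kronecker]
  fin_cases k <;> fin_cases l <;>
    simp [pauli, trace_fin_two] <;> linarith

lemma lambdaMax_diagonal {d : Fin 3 → ℝ} {m : ℝ} (h : IsGreatest (Set.range d) m) :
    lambdaMax (diagonal d) = m := by
  refine IsGreatest.csSup_eq ⟨?_, ?_⟩
  · obtain ⟨i, rfl⟩ := h.1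
    refine ⟨Pi.single i 1, by simp, ?_⟩
    ext j
    rcases eq_or_ne j i with rfl | hj <;> simp [mulVec_diagonal, *]
  · rintro x ⟨v, hv, hx⟩
    obtain ⟨i, hi⟩ := Function.ne_iff.mp hv
    have hxi := congrFun hx i
    rw [mulVec_diagonal, Pi.smul_apply, smul_eq_mul] at hxi
    rw [← mul_right_cancel₀ hi hxi]
    exact h.2 ⟨i, rfl⟩

lemma Frsp_of_corr_eq_diagonal {ρ : Matrix (Fin 2 × Fin 2) (Fin 2 × Fin 2) ℂ} {a b : ℝ}
    (h : corr ρ = diagonal ![a, 0, b]) :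
    Frsp ρ = (1 / 2) * min (a ^ 2) (b ^ 2) := by
  have hE : (corr ρ)ᵀ * corr ρ = diagonal ![a ^ 2, 0, b ^ 2] := by
    rw [h, diagonal_transpose, diagonal_mul_diagonal]
    congr 1
    ext i
    fin_cases i <;> simp [sq]
  have hmax : IsGreatest (Set.range ![a ^ 2, 0, b ^ 2]) (max (a ^ 2) (b ^ 2)) := by
    constructor
    · rcases max_choice (a ^ 2) (b ^ 2) with hm | hm <;> rw [hm]
      exacts [⟨0, rfl⟩, ⟨2, rfl⟩]
    · rintro _ ⟨i, rfl⟩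
      fin_cases i <;> simp [sq_nonneg]
  rw [Frsp, hE, lambdaMax_diagonal hmax, trace_diagonal, Fin.sum_univ_three]
  have := min_add_max (a ^ 2) (b ^ 2)
  simp
  linarith

/-- The classical Bell-diagonal state ρ(−1,0,0) has zero RSP-fidelity, but after any
nontrivial symmetric local amplitude damping channel its RSP-fidelity equals
½·min((1−p)², p⁴) and is strictly positive. -/
theorem frsp_classical_state_enhanced :
    Frsp (bellDiag (-1) 0 0) = 0 ∧
    ∀ p ∈ Set.Ioo (0 : ℝ) 1,
      Frsp (Phi p (bellDiag (-1) 0 0)) = (1 / 2) * min ((1 - p) ^ 2) (p ^ 4) ∧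
      0 < Frsp (Phi p (bellDiag (-1) 0 0)) := by
  refine ⟨?_, fun p hp => ?_⟩
  · rw [Frsp_of_corr_eq_diagonal corr_bellDiag_neg_one_zero_zero]
    norm_num
  · have hF : Frsp (Phi p (bellDiag (-1) 0 0)) = (1 / 2) * min ((1 - p) ^ 2) (p ^ 4) := by
      rw [Frsp_of_corr_eq_diagonal (corr_Phi_bellDiag_neg_one_zero_zero hp.1.le hp.2.le),
        neg_sq, ← pow_mul]
    have h₁ : 0 < 1 - p := sub_pos.mpr hp.2
    have h₂ : 0 < p := hp.1
    refine ⟨hF, ?_⟩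
    rw [hF]
    positivity

end
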